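/- Let K be a field of characteristic zero, R = K[x,y,z], and F = −x³ + y²z. Then Ann_R(F) is equal to the ideal (z², xz, xy, y³, x³ + 3y²z); in particular Ann_R(F) is a 5-generated Gorenstein ideal and A(F) is not a complete intersection. -/

import Mathlib

open MvPolynomial

noncomputable section

variable {K : Type} [Field K] {n : ℕ}

/-- The endomorphism `∂^d = ∏ i, (∂/∂x_i)^{d i}`. -/
def monOp (n : ℕ) (K : Type) [CommSemiring K] (d : Fin n →₀ ℕ) :
    Module.End K (MvPolynomial (Fin n) K) :=
  ((List.finRange n).map fun i =>
    ((MvPolynomial.pderiv i).toLinearMap : Module.End K (MvPolynomial (Fin n) K)) ^ d i).prod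

/-- `contr F f = f(∂/∂x₁, …, ∂/∂xₙ) F`, i.e. the result of applying to `F` the
constant-coefficient differential operator obtained from `f` by substituting
`∂/∂x_i` for `x_i`; it is a linear map in `f`. -/
def contr (F : MvPolynomial (Fin n) K) :
    MvPolynomial (Fin n) K →ₗ[K] MvPolynomial (Fin n) K :=
  (basisMonomials (Fin n) K).constr K fun d => monOp n K d F

end

/-- The exponent of `x ^ a * y ^ b * z ^ c`. -/
noncomputable def ternaryExponent (a b c : ℕ) : Fin 3 →₀ ℕ :=
  Finsupp.equivFunOnFinite.symm ![a, b, c]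

theorem ternaryExponent_inj {a b c a' b' c' : ℕ} :
    ternaryExponent a b c = ternaryExponent a' b' c' ↔ a = a' ∧ b = b' ∧ c = c' := by
  simp [ternaryExponent]

theorem exists_eq_ternaryExponent (d : Fin 3 →₀ ℕ) : ∃ a b c, d = ternaryExponent a b c := by
  refine ⟨d 0, d 1, d 2, ?_⟩
  ext i
  fin_cases i <;> simp [ternaryExponent]

section

variable {R : Type} [CommSemiring R]

theorem monomial_ternaryExponent (a b c : ℕ) (r : R) :
    monomial (ternaryExponent a b c) r = C r * (X 0 ^ a * X 1 ^ b * X 2 ^ c) := by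
  rw [monomial_eq, Finsupp.prod_fintype _ _ (by simp)]
  simp [Fin.prod_univ_three, ternaryExponent]

theorem coeff_ternaryExponent_X_zero_mul (a b c : ℕ) (f : MvPolynomial (Fin 3) R) :
    coeff (ternaryExponent a b c) (X 0 * f) =
      if a = 0 then 0 else coeff (ternaryExponent (a - 1) b c) f := by
  have h : ternaryExponent a b c - Finsupp.single 0 1 = ternaryExponent (a - 1) b c := by
    ext i; fin_cases i <;> simp [ternaryExponent]
  rw [coeff_X_mul', h]
  by_cases ha : a = 0 <;> simp [ha, ternaryExponent]

theorem coeff_ternaryExponent_X_one_mul (a b c : ℕ) (f : MvPolynomial (Fin 3) R) :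
    coeff (ternaryExponent a b c) (X 1 * f) =
      if b = 0 then 0 else coeff (ternaryExponent a (b - 1) c) f := by
  have h : ternaryExponent a b c - Finsupp.single 1 1 = ternaryExponent a (b - 1) c := by
    ext i; fin_cases i <;> simp [ternaryExponent]
  rw [coeff_X_mul', h]
  by_cases hb : b = 0 <;> simp [hb, ternaryExponent]

theorem coeff_ternaryExponent_X_two_mul (a b c : ℕ) (f : MvPolynomial (Fin 3) R) :
    coeff (ternaryExponent a b c) (X 2 * f) =
      if c = 0 then 0 else coeff (ternaryExponent a b (c - 1)) f := by
  have h : ternaryExponent a b c - Finsupp.single 2 1 = ternaryExponent a b (c - 1) := by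
    ext i; fin_cases i <;> simp [ternaryExponent]
  rw [coeff_X_mul', h]
  by_cases hc : c = 0 <;> simp [hc, ternaryExponent]

theorem coeff_ternaryExponent_monomial (a b c a' b' c' : ℕ) (r : R) :
    coeff (ternaryExponent a b c) (monomial (ternaryExponent a' b' c') r) =
      if a' = a ∧ b' = b ∧ c' = c then r else 0 := by
  classical
  simp only [coeff_monomial, ternaryExponent_inj]

theorem pderiv_zero_monomial_ternaryExponent (a b c : ℕ) (r : R) :
    pderiv 0 (monomial (ternaryExponent a b c) r) =
      monomial (ternaryExponent (a - 1) b c) (r * a) := by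
  have h : ternaryExponent a b c - Finsupp.single 0 1 = ternaryExponent (a - 1) b c := by
    ext i; fin_cases i <;> simp [ternaryExponent]
  rw [pderiv_monomial, h]
  simp [ternaryExponent]

theorem pderiv_one_monomial_ternaryExponent (a b c : ℕ) (r : R) :
    pderiv 1 (monomial (ternaryExponent a b c) r) =
      monomial (ternaryExponent a (b - 1) c) (r * b) := by
  have h : ternaryExponent a b c - Finsupp.single 1 1 = ternaryExponent a (b - 1) c := by
    ext i; fin_cases i <;> simp [ternaryExponent]
  rw [pderiv_monomial, h]
  simp [ternaryExponent]

theorem pderiv_two_monomial_ternaryExponent (a b c : ℕ) (r : R) :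
    pderiv 2 (monomial (ternaryExponent a b c) r) =
      monomial (ternaryExponent a b (c - 1)) (r * c) := by
  have h : ternaryExponent a b c - Finsupp.single 2 1 = ternaryExponent a b (c - 1) := by
    ext i; fin_cases i <;> simp [ternaryExponent]
  rw [pderiv_monomial, h]
  simp [ternaryExponent]

theorem iterate_pderiv_zero_monomial (a b c k : ℕ) (r : R) :
    (pderiv 0)^[k] (monomial (ternaryExponent a b c) r) =
      monomial (ternaryExponent (a - k) b c) (r * a.descFactorial k) := by
  induction k with
  | zero => simp
  | succ k ih =>
    rw [Function.iterate_succ_apply', ih, pderiv_zero_monomial_ternaryExponent, Nat.sub_sub,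
      Nat.descFactorial_succ]
    congr 1
    push_cast
    ring

theorem iterate_pderiv_one_monomial (a b c k : ℕ) (r : R) :
    (pderiv 1)^[k] (monomial (ternaryExponent a b c) r) =
      monomial (ternaryExponent a (b - k) c) (r * b.descFactorial k) := by
  induction k with
  | zero => simp
  | succ k ih =>
    rw [Function.iterate_succ_apply', ih, pderiv_one_monomial_ternaryExponent, Nat.sub_sub,
      Nat.descFactorial_succ]
    congr 1
    push_cast
    ring

theorem iterate_pderiv_two_monomial (a b c k : ℕ) (r : R) :
    (pderiv 2)^[k] (monomial (ternaryExponent a b c) r) =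
      monomial (ternaryExponent a b (c - k)) (r * c.descFactorial k) := by
  induction k with
  | zero => simp
  | succ k ih =>
    rw [Function.iterate_succ_apply', ih, pderiv_two_monomial_ternaryExponent, Nat.sub_sub,
      Nat.descFactorial_succ]
    congr 1
    push_cast
    ring

end

section

variable {K : Type} [Field K]

theorem contr_monomial {n : ℕ} (F : MvPolynomial (Fin n) K) (d : Fin n →₀ ℕ) (r : K) :
    contr F (monomial d r) = r • monOp n K d F := by
  have h : (monomial d r : MvPolynomial (Fin n) K) = r • basisMonomials (Fin n) K d := by
    simp [smul_monomial]
  rw [h, map_smul, contr, Module.Basis.constr_basis]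

theorem monOp_ternaryExponent_apply (a b c : ℕ) (F : MvPolynomial (Fin 3) K) :
    monOp 3 K (ternaryExponent a b c) F =
      (pderiv 0)^[a] ((pderiv 1)^[b] ((pderiv 2)^[c] F)) := by
  simp [monOp, ternaryExponent, List.finRange_succ, Module.End.pow_apply]

/-- The action of `f` on `-x ^ 3 + y ^ 2 * z`, in terms of the coefficients of `f`. -/
theorem contr_neg_x_cubed_add_y_sq_z (f : MvPolynomial (Fin 3) K) :
    contr (-(X 0 : MvPolynomial (Fin 3) K) ^ 3 + (X 1) ^ 2 * X 2) f =
      monomial (ternaryExponent 3 0 0) (-coeff (ternaryExponent 0 0 0) f)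
      + monomial (ternaryExponent 0 2 1) (coeff (ternaryExponent 0 0 0) f)
      + monomial (ternaryExponent 2 0 0) (-3 * coeff (ternaryExponent 1 0 0) f)
      + monomial (ternaryExponent 0 1 1) (2 * coeff (ternaryExponent 0 1 0) f)
      + monomial (ternaryExponent 0 2 0) (coeff (ternaryExponent 0 0 1) f)
      + monomial (ternaryExponent 1 0 0) (-6 * coeff (ternaryExponent 2 0 0) f)
      + monomial (ternaryExponent 0 0 1) (2 * coeff (ternaryExponent 0 2 0) f)
      + monomial (ternaryExponent 0 1 0) (2 * coeff (ternaryExponent 0 1 1) f)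
      + monomial (ternaryExponent 0 0 0) (2 * coeff (ternaryExponent 0 2 1) f
          - 6 * coeff (ternaryExponent 3 0 0) f) := by
  induction f using MvPolynomial.induction_on' with
  | add p q hp hq =>
    rw [map_add, hp, hq]
    simp only [monomial_ternaryExponent, coeff_add, map_add, map_sub, map_mul, map_neg]
    ring
  | monomial d r =>
    obtain ⟨a, b, c, rfl⟩ := exists_eq_ternaryExponent d
    rw [contr_monomial, monOp_ternaryExponent_apply]
    have hF : (-(X 0 : MvPolynomial (Fin 3) K) ^ 3 + (X 1) ^ 2 * X 2) =
        monomial (ternaryExponent 3 0 0) (-1) + monomial (ternaryExponent 0 2 1) 1 := by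
      simp [monomial_ternaryExponent]
    simp only [hF, iterate_map_add, iterate_pderiv_two_monomial, iterate_pderiv_one_monomial,
      iterate_pderiv_zero_monomial, coeff_ternaryExponent_monomial]
    rcases a with _ | _ | _ | _ | a <;> rcases b with _ | _ | _ | b <;>
      rcases c with _ | _ | c <;>
      simp [Nat.descFactorial, smul_monomial, mul_comm]

/-- The conditions on the coefficients of `f` which say that `f` annihilates
`-x ^ 3 + y ^ 2 * z`. -/
structure CoeffsVanish (f : MvPolynomial (Fin 3) K) : Prop where
  one : coeff (ternaryExponent 0 0 0) f = 0
  x : coeff (ternaryExponent 1 0 0) f = 0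
  y : coeff (ternaryExponent 0 1 0) f = 0
  z : coeff (ternaryExponent 0 0 1) f = 0
  x_sq : coeff (ternaryExponent 2 0 0) f = 0
  y_sq : coeff (ternaryExponent 0 2 0) f = 0
  y_mul_z : coeff (ternaryExponent 0 1 1) f = 0
  y_sq_mul_z : coeff (ternaryExponent 0 2 1) f = 3 * coeff (ternaryExponent 3 0 0) f

theorem contr_eq_zero_iff_coeffsVanish [CharZero K] (f : MvPolynomial (Fin 3) K) :
    contr (-(X 0 : MvPolynomial (Fin 3) K) ^ 3 + (X 1) ^ 2 * X 2) f = 0 ↔ CoeffsVanish f := by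
  rw [contr_neg_x_cubed_add_y_sq_z]
  constructor
  · intro h
    have hc (a b c : ℕ) := congrArg (coeff (ternaryExponent a b c)) h
    simp only [coeff_add, coeff_ternaryExponent_monomial, coeff_zero] at hc
    constructor
    · simpa using hc 0 2 1
    · simpa using hc 2 0 0
    · simpa using hc 0 1 1
    · simpa using hc 0 2 0
    · simpa using hc 1 0 0
    · simpa using hc 0 0 1
    · simpa using hc 0 1 0
    · have h0 := hc 0 0 0
      simp at h0
      linear_combination h0 / 2
  · rintro ⟨h1, h2, h3, h4, h5, h6, h7, h8⟩
    simp only [h1, h2, h3, h4, h5, h6, h7, h8]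
    ring_nf
    simp

theorem CoeffsVanish.add {f g : MvPolynomial (Fin 3) K} (hf : CoeffsVanish f)
    (hg : CoeffsVanish g) : CoeffsVanish (f + g) := by
  obtain ⟨f1, f2, f3, f4, f5, f6, f7, f8⟩ := hf
  obtain ⟨g1, g2, g3, g4, g5, g6, g7, g8⟩ := hg
  constructor <;> simp [*, mul_add]

theorem CoeffsVanish.X_mul {f : MvPolynomial (Fin 3) K} (hf : CoeffsVanish f) (i : Fin 3) :
    CoeffsVanish (X i * f) := by
  obtain ⟨f1, f2, f3, f4, f5, f6, f7, f8⟩ := hf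
  fin_cases i <;> constructor <;>
    simp [*, coeff_ternaryExponent_X_zero_mul, coeff_ternaryExponent_X_one_mul,
      coeff_ternaryExponent_X_two_mul]

theorem CoeffsVanish.mul {f : MvPolynomial (Fin 3) K} (hf : CoeffsVanish f)
    (r : MvPolynomial (Fin 3) K) : CoeffsVanish (r * f) := by
  induction r using MvPolynomial.induction_on with
  | C a =>
    obtain ⟨f1, f2, f3, f4, f5, f6, f7, f8⟩ := hf
    constructor <;> simp [*, coeff_C_mul, mul_left_comm]
  | add p q hp hq => rw [add_mul]; exact hp.add hq
  | mul_X p i hp => rw [mul_right_comm, mul_comm]; exact hp.X_mul i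

theorem CoeffsVanish.of_mem_span {s : Set (MvPolynomial (Fin 3) K)}
    (hs : ∀ f ∈ s, CoeffsVanish f) {f : MvPolynomial (Fin 3) K} (hf : f ∈ Ideal.span s) :
    CoeffsVanish f := by
  induction hf using Submodule.span_induction with
  | mem f hf => exact hs f hf
  | zero => constructor <;> simp
  | add f g _ _ hf hg => exact hf.add hg
  | smul r f _ hf => exact hf.mul r

/-- The generators `z ^ 2`, `x * z`, `x * y`, `y ^ 3`, `x ^ 3 + 3 * y ^ 2 * z`. -/
def annGenerators (K : Type) [Field K] : Set (MvPolynomial (Fin 3) K) :=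
  {(X 2) ^ 2, X 0 * X 2, X 0 * X 1, (X 1) ^ 3, (X 0) ^ 3 + 3 * (X 1) ^ 2 * X 2}

theorem coeffsVanish_of_mem_annGenerators {f : MvPolynomial (Fin 3) K}
    (hf : f ∈ annGenerators K) : CoeffsVanish f := by
  have e2 : (X 2 ^ 2 : MvPolynomial (Fin 3) K) = monomial (ternaryExponent 0 0 2) 1 := by
    simp [monomial_ternaryExponent]
  have e02 : (X 0 * X 2 : MvPolynomial (Fin 3) K) = monomial (ternaryExponent 1 0 1) 1 := by
    simp [monomial_ternaryExponent]
  have e01 : (X 0 * X 1 : MvPolynomial (Fin 3) K) = monomial (ternaryExponent 1 1 0) 1 := by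
    simp [monomial_ternaryExponent]
  have e1 : (X 1 ^ 3 : MvPolynomial (Fin 3) K) = monomial (ternaryExponent 0 3 0) 1 := by
    simp [monomial_ternaryExponent]
  have e012 : (X 0 ^ 3 + 3 * X 1 ^ 2 * X 2 : MvPolynomial (Fin 3) K) =
      monomial (ternaryExponent 3 0 0) 1 + monomial (ternaryExponent 0 2 1) 3 := by
    simp [monomial_ternaryExponent, mul_assoc, map_ofNat C 3]
  rw [annGenerators, e2, e02, e01, e1, e012] at hf
  rcases hf with rfl | rfl | rfl | rfl | rfl <;> constructor <;>
    simp [ternaryExponent_inj]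

/-- Every polynomial agrees modulo the generators with a combination of
`1, x, y, z, x ^ 2, y ^ 2, y * z, y ^ 2 * z`. -/
theorem sub_normalForm_mem_span_annGenerators (f : MvPolynomial (Fin 3) K) :
    f - (C (coeff (ternaryExponent 0 0 0) f) + C (coeff (ternaryExponent 1 0 0) f) * X 0
      + C (coeff (ternaryExponent 0 1 0) f) * X 1 + C (coeff (ternaryExponent 0 0 1) f) * X 2
      + C (coeff (ternaryExponent 2 0 0) f) * X 0 ^ 2
      + C (coeff (ternaryExponent 0 2 0) f) * X 1 ^ 2
      + C (coeff (ternaryExponent 0 1 1) f) * (X 1 * X 2)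
      + C (coeff (ternaryExponent 0 2 1) f - 3 * coeff (ternaryExponent 3 0 0) f)
        * (X 1 ^ 2 * X 2)) ∈ Ideal.span (annGenerators K) := by
  induction f using MvPolynomial.induction_on' with
  | add p q hp hq =>
    convert add_mem hp hq using 1
    simp only [coeff_add, map_add, map_sub, map_mul]
    ring
  | monomial d r =>
    obtain ⟨a, b, c, rfl⟩ := exists_eq_ternaryExponent d
    have m1 : (X 2 ^ 2 : MvPolynomial (Fin 3) K) ∈ Ideal.span (annGenerators K) :=
      Ideal.subset_span (by simp [annGenerators])
    have m2 : (X 0 * X 2 : MvPolynomial (Fin 3) K) ∈ Ideal.span (annGenerators K) :=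
      Ideal.subset_span (by simp [annGenerators])
    have m3 : (X 0 * X 1 : MvPolynomial (Fin 3) K) ∈ Ideal.span (annGenerators K) :=
      Ideal.subset_span (by simp [annGenerators])
    have m4 : (X 1 ^ 3 : MvPolynomial (Fin 3) K) ∈ Ideal.span (annGenerators K) :=
      Ideal.subset_span (by simp [annGenerators])
    have m5 : (X 0 ^ 3 + 3 * X 1 ^ 2 * X 2 : MvPolynomial (Fin 3) K) ∈
        Ideal.span (annGenerators K) :=
      Ideal.subset_span (by simp [annGenerators])
    have m6 : (X 0 ^ 4 : MvPolynomial (Fin 3) K) ∈ Ideal.span (annGenerators K) := by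
      convert sub_mem (Ideal.mul_mem_left _ (X 0) m5)
        (Ideal.mul_mem_left _ (3 * X 1 * X 2) m3) using 1
      ring
    have hC : (C 3 : MvPolynomial (Fin 3) K) = 3 := map_ofNat C 3
    simp only [coeff_ternaryExponent_monomial]
    simp only [monomial_ternaryExponent]
    rcases c with _ | _ | c
    · rcases b with _ | b
      · rcases a with _ | _ | _ | _ | a
        · simp
        · simp
        · simp
        · convert Ideal.mul_mem_left _ (C r) m5 using 1
          simp [hC]
          ring
        · convert Ideal.mul_mem_left _ (C r * X 0 ^ a) m6 using 1
          simp
          ring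
      · rcases a with _ | a
        · rcases b with _ | _ | b
          · simp
          · simp
          · convert Ideal.mul_mem_left _ (C r * X 1 ^ b) m4 using 1
            simp
            ring
        · convert Ideal.mul_mem_left _ (C r * X 0 ^ a * X 1 ^ b) m3 using 1
          simp
          ring
    · rcases a with _ | a
      · rcases b with _ | _ | _ | b
        · simp
        · simp
        · simp
        · convert Ideal.mul_mem_left _ (C r * X 1 ^ b * X 2) m4 using 1
          simp
          ring
      · convert Ideal.mul_mem_left _ (C r * X 0 ^ a * X 1 ^ b) m2 using 1
        simp
        ring
    · convert Ideal.mul_mem_left _ (C r * X 0 ^ a * X 1 ^ b * X 2 ^ c) m1 using 1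
      simp
      ring

theorem mem_span_annGenerators_iff (f : MvPolynomial (Fin 3) K) :
    f ∈ Ideal.span (annGenerators K) ↔ CoeffsVanish f := by
  refine ⟨CoeffsVanish.of_mem_span fun _ => coeffsVanish_of_mem_annGenerators, ?_⟩
  rintro ⟨h1, h2, h3, h4, h5, h6, h7, h8⟩
  simpa [h1, h2, h3, h4, h5, h6, h7, h8] using sub_normalForm_mem_span_annGenerators f

/-- The coefficients of `z ^ 2`, `x * z`, `x * y`, `y ^ 3`, `x ^ 3`, which give coordinates
on the annihilator modulo its product with the maximal ideal `(x, y, z)`. -/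
noncomputable def generatorCoeffs (K : Type) [Field K] :
    MvPolynomial (Fin 3) K →ₗ[K] (Fin 5 → K) :=
  LinearMap.pi ![lcoeff K (ternaryExponent 0 0 2), lcoeff K (ternaryExponent 1 0 1),
    lcoeff K (ternaryExponent 1 1 0), lcoeff K (ternaryExponent 0 3 0),
    lcoeff K (ternaryExponent 3 0 0)]

theorem generatorCoeffs_apply (f : MvPolynomial (Fin 3) K) :
    generatorCoeffs K f = ![coeff (ternaryExponent 0 0 2) f, coeff (ternaryExponent 1 0 1) f,
      coeff (ternaryExponent 1 1 0) f, coeff (ternaryExponent 0 3 0) f,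
      coeff (ternaryExponent 3 0 0) f] := by
  ext i
  fin_cases i <;> rfl

theorem CoeffsVanish.generatorCoeffs_X_mul {f : MvPolynomial (Fin 3) K} (hf : CoeffsVanish f)
    (i : Fin 3) : generatorCoeffs K (X i * f) = 0 := by
  obtain ⟨f1, f2, f3, f4, f5, f6, f7, f8⟩ := hf
  rw [generatorCoeffs_apply]
  fin_cases i <;>
    simp [*, coeff_ternaryExponent_X_zero_mul, coeff_ternaryExponent_X_one_mul,
      coeff_ternaryExponent_X_two_mul]

theorem CoeffsVanish.generatorCoeffs_mul_mem {f : MvPolynomial (Fin 3) K} (hf : CoeffsVanish f)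
    {S : Submodule K (Fin 5 → K)} (hS : generatorCoeffs K f ∈ S) (r : MvPolynomial (Fin 3) K) :
    generatorCoeffs K (r * f) ∈ S := by
  induction r using MvPolynomial.induction_on with
  | C a => rw [C_mul', map_smul]; exact S.smul_mem a hS
  | add p q hp hq => rw [add_mul, map_add]; exact add_mem hp hq
  | mul_X p i _ =>
    rw [mul_right_comm, mul_comm, (hf.mul p).generatorCoeffs_X_mul i]
    exact zero_mem S

theorem generatorCoeffs_mem_of_mem_span {s : Set (MvPolynomial (Fin 3) K)}
    (hs : ∀ f ∈ s, CoeffsVanish f) {f : MvPolynomial (Fin 3) K} (hf : f ∈ Ideal.span s) :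
    generatorCoeffs K f ∈ Submodule.span K (generatorCoeffs K '' s) := by
  induction hf using Submodule.span_induction with
  | mem f hf => exact Submodule.subset_span ⟨f, hf, rfl⟩
  | zero => rw [map_zero]; exact zero_mem _
  | add f g _ _ hf hg => rw [map_add]; exact add_mem hf hg
  | smul r f hfs hf => exact (CoeffsVanish.of_mem_span hs hfs).generatorCoeffs_mul_mem hf r

theorem exists_coeffsVanish_generatorCoeffs_eq (v : Fin 5 → K) :
    ∃ f : MvPolynomial (Fin 3) K, CoeffsVanish f ∧ generatorCoeffs K f = v := by
  refine ⟨monomial (ternaryExponent 0 0 2) (v 0) + monomial (ternaryExponent 1 0 1) (v 1)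
    + monomial (ternaryExponent 1 1 0) (v 2) + monomial (ternaryExponent 0 3 0) (v 3)
    + monomial (ternaryExponent 3 0 0) (v 4) + monomial (ternaryExponent 0 2 1) (3 * v 4),
    ?_, ?_⟩
  · constructor <;> simp [ternaryExponent_inj]
  · rw [generatorCoeffs_apply]
    ext i
    fin_cases i <;> simp [ternaryExponent_inj]

theorem five_le_of_setOf_coeffsVanish_eq_span {m : ℕ} (g : Fin m → MvPolynomial (Fin 3) K)
    (hg : {f : MvPolynomial (Fin 3) K | CoeffsVanish f} = ↑(Ideal.span (Set.range g))) :
    5 ≤ m := by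
  have hs : ∀ f ∈ Set.range g, CoeffsVanish f := fun f hf =>
    hg.symm.subset (Ideal.subset_span hf)
  have htop : Submodule.span K (Set.range (generatorCoeffs K ∘ g)) = ⊤ := by
    rw [eq_top_iff]
    intro v _
    obtain ⟨f, hf, rfl⟩ := exists_coeffsVanish_generatorCoeffs_eq v
    rw [Set.range_comp]
    exact generatorCoeffs_mem_of_mem_span hs (hg.subset hf)
  have h := finrank_range_le_card (R := K) (generatorCoeffs K ∘ g)
  rw [Set.finrank, htop] at h
  simpa using h

end

/-- For `F = −x³ + y²z` in `K[x,y,z]` (char `K` = 0),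
`Ann_R(F) = (z², xz, xy, y³, x³ + 3y²z)`; in particular `A(F)` is not a
complete intersection (`Ann_R(F)` is not generated by a regular sequence of
three elements). Here `x = X 0`, `y = X 1`, `z = X 2`. -/
theorem ann_of_neg_x_cubed_add_y_sq_z {K : Type} [Field K] [CharZero K] :
    {f : MvPolynomial (Fin 3) K |
        contr (-(X 0 : MvPolynomial (Fin 3) K) ^ 3 + (X 1) ^ 2 * X 2) f = 0}
      = ↑(Ideal.span ({(X 2) ^ 2, X 0 * X 2, X 0 * X 1, (X 1) ^ 3,
          (X 0) ^ 3 + 3 * (X 1) ^ 2 * X 2} : Set (MvPolynomial (Fin 3) K)))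
    ∧ ¬ ∃ g : Fin 3 → MvPolynomial (Fin 3) K,
        RingTheory.Sequence.IsRegular (MvPolynomial (Fin 3) K) (List.ofFn g) ∧
        {f : MvPolynomial (Fin 3) K |
            contr (-(X 0 : MvPolynomial (Fin 3) K) ^ 3 + (X 1) ^ 2 * X 2) f = 0}
          = ↑(Ideal.span (Set.range g)) := by
  simp only [contr_eq_zero_iff_coeffsVanish]
  refine ⟨?_, ?_⟩
  · ext f
    exact (mem_span_annGenerators_iff f).symm
  · rintro ⟨g, -, hg⟩
    have h := five_le_of_setOf_coeffsVanish_eq_span g hg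
    omega
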